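/- Let G be a Garside group of finite type, x ∈ G, y ∈ SC(x) and s ∈ G such that y^s ∈ SSS(x). Let N be a positive integer with 𝔰^N(y) = y, and for integers i ≥ 0 consider the iterated transports s^{(iN)} at y. Then: (1) there are integers i₂ > i₁ ≥ 0 such that s^{(i₁N)} = s^{(i₂N)}; (2) y^s ∈ SC(x) if and only if there is a positive integer k such that s^{(kN)} = s. -/

import Mathlib

/-- A Garside structure of finite type on a group `G`: a submonoid `P` of positive
elements with `P ∩ P⁻¹ = {1}`, such that the prefix order `a ⪯ b ↔ a⁻¹ * b ∈ P` is a
lattice order (with meet `wedge` and join `vee`), together with a Garside element `Δ ∈ P`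
whose set of prefixes (the simple elements) is finite and generates `G`, satisfying
`Δ⁻¹ P Δ = P`, and such that every nontrivial positive element has a finite norm. -/
structure GarsideStructure (G : Type*) [Group G] where
  P : Set G
  one_mem : (1 : G) ∈ P
  mul_mem : ∀ {a b : G}, a ∈ P → b ∈ P → a * b ∈ P
  eq_one_of_mem_of_inv_mem : ∀ a : G, a ∈ P → a⁻¹ ∈ P → a = 1
  wedge : G → G → G
  vee : G → G → G
  wedge_le_left : ∀ a b : G, (wedge a b)⁻¹ * a ∈ P
  wedge_le_right : ∀ a b : G, (wedge a b)⁻¹ * b ∈ P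
  le_wedge : ∀ a b c : G, c⁻¹ * a ∈ P → c⁻¹ * b ∈ P → c⁻¹ * wedge a b ∈ P
  le_vee_left : ∀ a b : G, a⁻¹ * vee a b ∈ P
  le_vee_right : ∀ a b : G, b⁻¹ * vee a b ∈ P
  vee_le : ∀ a b c : G, a⁻¹ * c ∈ P → b⁻¹ * c ∈ P → (vee a b)⁻¹ * c ∈ P
  Δ : G
  Δ_mem : Δ ∈ P
  simples_finite : {s : G | s ∈ P ∧ s⁻¹ * Δ ∈ P}.Finite
  simples_generate : Subgroup.closure {s : G | s ∈ P ∧ s⁻¹ * Δ ∈ P} = (⊤ : Subgroup G)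
  conj_Delta_mem : ∀ a : G, a ∈ P → Δ⁻¹ * a * Δ ∈ P
  mem_of_conj_Delta_mem : ∀ a : G, Δ⁻¹ * a * Δ ∈ P → a ∈ P
  norm_bounded : ∀ x : G, x ∈ P → x ≠ 1 →
    ∃ n : ℕ, ∀ L : List G, (∀ a ∈ L, a ∈ P ∧ a ≠ 1) → L.prod = x → L.length ≤ n

namespace GarsideStructure

variable {G : Type*} [Group G] (gs : GarsideStructure G)

/-- The prefix order: `a ⪯ b`. -/
def pre (a b : G) : Prop := a⁻¹ * b ∈ gs.P

/-- The suffix order: `a ≽ b` (i.e. `b` is a suffix of `a`). -/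
def rdvd (a b : G) : Prop := a * b⁻¹ ∈ gs.P

/-- Greatest common divisor with respect to the suffix order `≽` : `a ∧↰ b`. -/
def rwedge (a b : G) : G := (gs.vee a⁻¹ b⁻¹)⁻¹

/-- Least common multiple with respect to the suffix order `≽` : `a ∨↰ b`. -/
def rvee (a b : G) : G := (gs.wedge a⁻¹ b⁻¹)⁻¹

/-- Simple elements: positive prefixes of `Δ`. -/
def simple (s : G) : Prop := s ∈ gs.P ∧ s⁻¹ * gs.Δ ∈ gs.P

/-- Atoms: nontrivial positive elements which cannot be decomposed in `P`. -/
def atom (a : G) : Prop := a ∈ gs.P ∧ a ≠ 1 ∧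
  ∀ b c : G, b ∈ gs.P → c ∈ gs.P → a = b * c → b = 1 ∨ c = 1

/-- `inf x` : the maximal integer `p` with `Δ^p ⪯ x`. -/
noncomputable def ginf (x : G) : ℤ := sSup {p : ℤ | gs.pre (gs.Δ ^ p) x}

/-- `sup x` : the minimal integer `p` with `x ⪯ Δ^p`. -/
noncomputable def gsup (x : G) : ℤ := sInf {p : ℤ | gs.pre x (gs.Δ ^ p)}

/-- Canonical length `ℓ(x) = sup(x) - inf(x)`. -/
noncomputable def glen (x : G) : ℤ := gs.gsup x - gs.ginf x

/-- `‖x‖` : the maximal number of factors in a decomposition of `x` as a product of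
nontrivial positive elements. -/
noncomputable def gnorm (x : G) : ℕ :=
  sSup {k : ℕ | ∃ L : List G, (∀ a ∈ L, a ∈ gs.P ∧ a ≠ 1) ∧ L.prod = x ∧ L.length = k}

/-- The summit infimum `inf_s(x)` : the maximum of `inf` over the conjugacy class of `x`. -/
noncomputable def ginfs (x : G) : ℤ :=
  sSup {p : ℤ | ∃ y : G, (∃ α : G, α⁻¹ * x * α = y) ∧ p = gs.ginf y}

/-- The summit supremum `sup_s(x)` : the minimum of `sup` over the conjugacy class of `x`. -/
noncomputable def gsups (x : G) : ℤ :=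
  sInf {p : ℤ | ∃ y : G, (∃ α : G, α⁻¹ * x * α = y) ∧ p = gs.gsup y}

/-- The preferred prefix `𝔭(x) = (xΔ^{-inf x}) ∧ (x⁻¹Δ^{sup x}) ∧ Δ`. -/
noncomputable def pp (x : G) : G :=
  gs.wedge (gs.wedge (x * gs.Δ ^ (-gs.ginf x)) (x⁻¹ * gs.Δ ^ gs.gsup x)) gs.Δ

/-- Cyclic (left) sliding `𝔰(x) = 𝔭(x)⁻¹ x 𝔭(x)`. -/
noncomputable def sl (x : G) : G := (gs.pp x)⁻¹ * x * gs.pp x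

/-- The preferred suffix `𝔭↰(x) = (Δ^{-inf x}x) ∧↰ (Δ^{sup x}x⁻¹) ∧↰ Δ`. -/
noncomputable def ps (x : G) : G :=
  gs.rwedge (gs.rwedge (gs.Δ ^ (-gs.ginf x) * x) (gs.Δ ^ gs.gsup x * x⁻¹)) gs.Δ

/-- Cyclic right sliding `𝔰↰(x) = 𝔭↰(x) x 𝔭↰(x)⁻¹`. -/
noncomputable def rsl (x : G) : G := gs.ps x * x * (gs.ps x)⁻¹

/-- The super summit set `SSS(x)` : conjugates of `x` with maximal infimum and minimal
supremum among all conjugates of `x`. -/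
def SSS (x : G) : Set G :=
  {y | (∃ α : G, α⁻¹ * x * α = y) ∧
    ∀ z : G, (∃ α : G, α⁻¹ * x * α = z) → gs.ginf z ≤ gs.ginf y ∧ gs.gsup y ≤ gs.gsup z}

/-- The set of sliding circuits `SC(x)` : conjugates `y` of `x` with `𝔰^m(y) = y` for
some `m ≥ 1`. -/
noncomputable def SC (x : G) : Set G :=
  {y | (∃ α : G, α⁻¹ * x * α = y) ∧ ∃ m : ℕ, 1 ≤ m ∧ (gs.sl)^[m] y = y}

/-- The transport `α^{(1)} = 𝔭(x)⁻¹ α 𝔭(x^α)` of `α` at `x`. -/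
noncomputable def transport (x α : G) : G := (gs.pp x)⁻¹ * α * gs.pp (α⁻¹ * x * α)

/-- Iterated transport `α^{(i)}` of `α` at `x`: `α^{(0)} = α` and `α^{(i+1)}` is the
transport of `α^{(i)}` at `𝔰^i(x)`. -/
noncomputable def transportIter (x α : G) : ℕ → G
  | 0 => α
  | i + 1 => gs.transport ((gs.sl)^[i] x) (transportIter x α i)

/-- `c` is the `⪯`-minimal element `c_s(y)` satisfying `s ⪯ c` and `y^c ∈ SC(x)`. -/
def IsMinSCConj (x y s c : G) : Prop :=
  gs.pre s c ∧ (c⁻¹ * y * c) ∈ gs.SC x ∧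
    ∀ d : G, gs.pre s d → (d⁻¹ * y * d) ∈ gs.SC x → gs.pre c d

/-- `s` is an indecomposable conjugator starting at `u`: `u^s ∈ SC(x)`, `s ≠ 1` and there
is no `t` with `1 ≺ t ≺ s` and `u^t ∈ SC(x)`. -/
def IsIndecomposableConjugator (x u s : G) : Prop :=
  (s⁻¹ * u * s) ∈ gs.SC x ∧ s ≠ 1 ∧
    ¬ ∃ t : G, (gs.pre 1 t ∧ t ≠ 1) ∧ (gs.pre t s ∧ t ≠ s) ∧ (t⁻¹ * u * t) ∈ gs.SC x

/-- `u` is the pullback of `s` at `y = 𝔰(z)` : the `⪯`-minimal positive element with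
`z^u ∈ SSS(x)` and `s ⪯ u^{(1)}` (transport at `z`). -/
def IsPullback (x z s u : G) : Prop :=
  u ∈ gs.P ∧ (u⁻¹ * z * u) ∈ gs.SSS x ∧ gs.pre s (gs.transport z u) ∧
    ∀ u' : G, u' ∈ gs.P → (u'⁻¹ * z * u') ∈ gs.SSS x → gs.pre s (gs.transport z u') →
      gs.pre u u'

/-- The pullback `s_{(1)}` of `s` at `y = 𝔰(z)`. -/
noncomputable def pullbackOne (x z s : G) : G :=
  @Classical.epsilon G ⟨1⟩ (fun u => gs.IsPullback x z s u)

/-- The `k`-fold pullback `s_{(k)}` of `s` at `y = 𝔰^k(z)` (an element at `z`):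
`s_{(0)} = s` and `s_{(k+1)}` is the pullback at `𝔰(z)` (relative to `z`) of the `k`-fold
pullback of `s` at `𝔰^k(𝔰(z)) = y`. -/
noncomputable def pullbackIter (x : G) : G → ℕ → G → G
  | _, 0, s => s
  | z, k + 1, s => gs.pullbackOne x z (pullbackIter x (gs.sl z) k s)

end GarsideStructure

namespace GarsideStructure

variable {G : Type*} [Group G] (gs : GarsideStructure G)

theorem pre_refl (a : G) : gs.pre a a := by simpa [pre] using gs.one_mem

variable {gs} in
theorem pre.trans {a b c : G} (h : gs.pre a b) (h' : gs.pre b c) : gs.pre a c := by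
  simpa [pre, mul_assoc] using gs.mul_mem h h'

variable {gs} in
theorem pre.antisymm {a b : G} (h : gs.pre a b) (h' : gs.pre b a) : a = b := by
  have := gs.eq_one_of_mem_of_inv_mem (a⁻¹ * b) h (by simpa [pre] using h')
  exact inv_mul_eq_one.mp this

theorem pre_mul_left_iff (g a b : G) : gs.pre (g * a) (g * b) ↔ gs.pre a b := by
  simp [pre, mul_assoc]

variable {gs} in
theorem pre.mul_left {a b : G} (h : gs.pre a b) (g : G) : gs.pre (g * a) (g * b) :=
  (gs.pre_mul_left_iff g a b).2 h

theorem pre_mul_of_mem (a : G) {u : G} (hu : u ∈ gs.P) : gs.pre a (a * u) := by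
  simpa [pre] using hu

theorem conj_Delta_zpow_mem {a : G} (ha : a ∈ gs.P) (k : ℤ) :
    (gs.Δ ^ k)⁻¹ * a * gs.Δ ^ k ∈ gs.P := by
  induction k with
  | zero => simpa using ha
  | succ n ih =>
    have := gs.conj_Delta_mem _ ih
    rw [zpow_add_one]
    simpa [mul_assoc] using this
  | pred n ih =>
    refine gs.mem_of_conj_Delta_mem _ ?_
    rw [zpow_sub_one]
    simpa [mul_assoc] using ih

variable {gs} in
theorem pre.mul_zpow {a b : G} (h : gs.pre a b) (k : ℤ) :
    gs.pre (a * gs.Δ ^ k) (b * gs.Δ ^ k) := by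
  have := gs.conj_Delta_zpow_mem h k
  simpa [pre, mul_assoc] using this

theorem pre_mul_zpow_iff (a b : G) (k : ℤ) :
    gs.pre (a * gs.Δ ^ k) (b * gs.Δ ^ k) ↔ gs.pre a b := by
  refine ⟨fun h => ?_, fun h => h.mul_zpow k⟩
  simpa [mul_assoc] using h.mul_zpow (-k)

theorem Delta_zpow_mem {k : ℤ} (hk : 0 ≤ k) : gs.Δ ^ k ∈ gs.P := by
  lift k to ℕ using hk
  induction k with
  | zero => simpa using gs.one_mem
  | succ n ih =>
    push_cast
    rw [zpow_add_one]
    exact gs.mul_mem ih gs.Δ_mem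

theorem Delta_zpow_pre {k l : ℤ} (h : k ≤ l) : gs.pre (gs.Δ ^ k) (gs.Δ ^ l) := by
  rw [pre, ← zpow_neg, ← zpow_add]
  exact gs.Delta_zpow_mem (by lia)

theorem mul_Delta_zpow_pre (a : G) {k l : ℤ} (h : k ≤ l) :
    gs.pre (a * gs.Δ ^ k) (a * gs.Δ ^ l) :=
  (gs.Delta_zpow_pre h).mul_left a

theorem wedge_pre_left (a b : G) : gs.pre (gs.wedge a b) a := gs.wedge_le_left a b

theorem wedge_pre_right (a b : G) : gs.pre (gs.wedge a b) b := gs.wedge_le_right a b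

variable {gs} in
theorem pre.wedge {a b c : G} (h : gs.pre c a) (h' : gs.pre c b) : gs.pre c (gs.wedge a b) :=
  gs.le_wedge a b c h h'

theorem mul_wedge (g a b : G) : g * gs.wedge a b = gs.wedge (g * a) (g * b) := by
  refine pre.antisymm (pre.wedge ((gs.wedge_pre_left a b).mul_left g)
    ((gs.wedge_pre_right a b).mul_left g)) ?_
  rw [← gs.pre_mul_left_iff g⁻¹, inv_mul_cancel_left]
  refine pre.wedge ?_ ?_ <;> rw [← gs.pre_mul_left_iff g, mul_inv_cancel_left]
  exacts [gs.wedge_pre_left _ _, gs.wedge_pre_right _ _]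

theorem wedge_mul_zpow (a b : G) (k : ℤ) :
    gs.wedge a b * gs.Δ ^ k = gs.wedge (a * gs.Δ ^ k) (b * gs.Δ ^ k) := by
  refine pre.antisymm (pre.wedge ((gs.wedge_pre_left a b).mul_zpow k)
    ((gs.wedge_pre_right a b).mul_zpow k)) ?_
  rw [← gs.pre_mul_zpow_iff _ _ (-k), mul_assoc (gs.wedge a b), ← zpow_add, add_neg_cancel,
    zpow_zero, mul_one]
  refine pre.wedge ?_ ?_ <;> rw [← gs.pre_mul_zpow_iff _ _ k, mul_assoc, ← zpow_add,
    neg_add_cancel, zpow_zero, mul_one]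
  exacts [gs.wedge_pre_left _ _, gs.wedge_pre_right _ _]

theorem wedge_comm (a b : G) : gs.wedge a b = gs.wedge b a :=
  pre.antisymm ((gs.wedge_pre_right a b).wedge (gs.wedge_pre_left a b))
    ((gs.wedge_pre_right b a).wedge (gs.wedge_pre_left b a))

/-- Every element lies between two powers of `Δ`. -/
theorem exists_Delta_zpow_bounds (x : G) :
    ∃ k : ℤ, gs.pre (gs.Δ ^ (-k)) x ∧ gs.pre x (gs.Δ ^ k) := by
  have hx : x ∈ Subgroup.closure {s : G | s ∈ gs.P ∧ s⁻¹ * gs.Δ ∈ gs.P} := by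
    rw [gs.simples_generate]; trivial
  induction hx using Subgroup.closure_induction with
  | mem s hs =>
    refine ⟨1, (gs.Delta_zpow_pre (k := -1) (l := 0) (by lia)).trans ?_, ?_⟩
    · simpa [pre] using hs.1
    · simpa [pre] using hs.2
  | one => exact ⟨0, by simpa using gs.pre_refl 1, by simpa using gs.pre_refl 1⟩
  | mul a b _ _ iha ihb =>
    obtain ⟨k, hk, hk'⟩ := iha
    obtain ⟨l, hl, hl'⟩ := ihb
    refine ⟨k + l, ?_, ?_⟩
    · rw [neg_add, zpow_add]
      exact (hk.mul_zpow (-l)).trans (hl.mul_left a)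
    · rw [zpow_add]
      exact (hl'.mul_left a).trans (hk'.mul_zpow l)
  | inv a _ ih =>
    obtain ⟨k, hk, hk'⟩ := ih
    refine ⟨k, ?_, ?_⟩
    · simpa using (hk'.mul_left a⁻¹).mul_zpow (-k)
    · simpa using (hk.mul_left a⁻¹).mul_zpow k

theorem eq_one_of_Delta_eq_one (h : gs.Δ = 1) (g : G) : g = 1 := by
  obtain ⟨k, hk, hk'⟩ := gs.exists_Delta_zpow_bounds g
  rw [h, one_zpow] at hk hk'
  exact hk'.antisymm hk

theorem le_of_Delta_zpow_pre (hΔ : gs.Δ ≠ 1) {k l : ℤ} (h : gs.pre (gs.Δ ^ k) (gs.Δ ^ l)) :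
    k ≤ l := by
  by_contra! hlt
  refine hΔ (gs.eq_one_of_mem_of_inv_mem _ gs.Δ_mem ?_)
  rw [pre, ← zpow_neg, ← zpow_add] at h
  have := gs.mul_mem h (gs.Delta_zpow_mem (k := k - l - 1) (by lia))
  rw [← zpow_add] at this
  rw [← zpow_neg_one]
  convert this using 2
  ring

theorem Delta_zpow_pre_iff_le_ginf (hΔ : gs.Δ ≠ 1) (x : G) (k : ℤ) :
    gs.pre (gs.Δ ^ k) x ↔ k ≤ gs.ginf x := by
  obtain ⟨l, hl, hl'⟩ := gs.exists_Delta_zpow_bounds x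
  have hbdd : BddAbove {p : ℤ | gs.pre (gs.Δ ^ p) x} :=
    ⟨l, fun p hp => gs.le_of_Delta_zpow_pre hΔ (pre.trans hp hl')⟩
  exact ⟨fun h => le_csSup hbdd h,
    fun h => (gs.Delta_zpow_pre h).trans (Int.csSup_mem ⟨_, hl⟩ hbdd)⟩

theorem pre_Delta_zpow_iff_inv (x : G) (k : ℤ) :
    gs.pre x (gs.Δ ^ k) ↔ gs.pre (gs.Δ ^ (-k)) x⁻¹ := by
  refine ⟨fun h => ?_, fun h => ?_⟩
  · simpa using (h.mul_left x⁻¹).mul_zpow (-k)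
  · simpa using (h.mul_left x).mul_zpow k

theorem gsup_eq_neg_ginf_inv (x : G) : gs.gsup x = -gs.ginf x⁻¹ := by
  have : {p : ℤ | gs.pre x (gs.Δ ^ p)} = -{p : ℤ | gs.pre (gs.Δ ^ p) x⁻¹} := by
    ext p; simp [gs.pre_Delta_zpow_iff_inv x p]
  rw [gsup, ginf, this]
  obtain ⟨k, hk, -⟩ := gs.exists_Delta_zpow_bounds x⁻¹
  by_cases hb : BddAbove {p : ℤ | gs.pre (gs.Δ ^ p) x⁻¹}
  · exact csInf_neg ⟨_, hk⟩ hb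
  · rw [Int.csSup_of_not_bddAbove hb, Int.csInf_of_not_bddBelow (by rwa [bddBelow_neg]), neg_zero]

theorem pre_Delta_zpow_iff_gsup_le (hΔ : gs.Δ ≠ 1) (x : G) (k : ℤ) :
    gs.pre x (gs.Δ ^ k) ↔ gs.gsup x ≤ k := by
  rw [gs.pre_Delta_zpow_iff_inv, gs.Delta_zpow_pre_iff_le_ginf hΔ, gsup_eq_neg_ginf_inv]
  lia

theorem pp_inv (x : G) : gs.pp x⁻¹ = gs.pp x := by
  have h : gs.gsup x⁻¹ = -gs.ginf x := by rw [gsup_eq_neg_ginf_inv, inv_inv]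
  rw [pp, pp, h, gs.gsup_eq_neg_ginf_inv x, inv_inv, gs.wedge_comm (x⁻¹ * _)]

theorem sl_inv (x : G) : gs.sl x⁻¹ = (gs.sl x)⁻¹ := by
  simp [sl, pp_inv, mul_assoc]

theorem sl_iterate_inv (x : G) (n : ℕ) : gs.sl^[n] x⁻¹ = (gs.sl^[n] x)⁻¹ := by
  induction n with
  | zero => rfl
  | succ n ih => rw [Function.iterate_succ_apply', ih, sl_inv, Function.iterate_succ_apply']

theorem pp_mem (hΔ : gs.Δ ≠ 1) (x : G) : gs.pp x ∈ gs.P := by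
  suffices h : gs.pre 1 (gs.pp x) by simpa [pre] using h
  refine pre.wedge (pre.wedge ?_ ?_) (by simpa [pre] using gs.Δ_mem)
  · simpa [← zpow_add] using
      ((gs.Delta_zpow_pre_iff_le_ginf hΔ x _).2 le_rfl).mul_zpow (-gs.ginf x)
  · simpa [← zpow_add] using ((gs.pre_Delta_zpow_iff_gsup_le hΔ x _).2 le_rfl).mul_left x⁻¹

theorem ginf_le_ginf_sl (hΔ : gs.Δ ≠ 1) (x : G) : gs.ginf x ≤ gs.ginf (gs.sl x) := by
  rw [← gs.Delta_zpow_pre_iff_le_ginf hΔ, sl, ← gs.pre_mul_left_iff (gs.pp x)]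
  have h : gs.pre (gs.pp x) (x * gs.Δ ^ (-gs.ginf x)) :=
    (gs.wedge_pre_left _ _).trans (gs.wedge_pre_left _ _)
  have h' := h.mul_zpow (gs.ginf x)
  rw [mul_assoc x, ← zpow_add, neg_add_cancel, zpow_zero, mul_one] at h'
  simpa [mul_assoc] using h'.trans (gs.pre_mul_of_mem x (gs.pp_mem hΔ x))

theorem ginf_le_ginf_sl_iterate (hΔ : gs.Δ ≠ 1) (x : G) (n : ℕ) :
    gs.ginf x ≤ gs.ginf (gs.sl^[n] x) := by
  induction n with
  | zero => rfl
  | succ n ih =>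
    rw [Function.iterate_succ_apply']
    exact ih.trans (gs.ginf_le_ginf_sl hΔ _)

theorem ginf_sl_iterate_eq (hΔ : gs.Δ ≠ 1) {y : G} {N : ℕ} (hN : 0 < N)
    (hy : gs.sl^[N] y = y) (n : ℕ) : gs.ginf (gs.sl^[n] y) = gs.ginf y := by
  refine le_antisymm ?_ (gs.ginf_le_ginf_sl_iterate hΔ y n)
  have hper : gs.sl^[N * n] y = y := by
    rw [Function.iterate_mul]; exact Function.iterate_fixed hy n
  have h := gs.ginf_le_ginf_sl_iterate hΔ (gs.sl^[n] y) (N * n - n)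
  rwa [← Function.iterate_add_apply, Nat.sub_add_cancel (Nat.le_mul_of_pos_left n hN), hper] at h

theorem gsup_sl_iterate_eq (hΔ : gs.Δ ≠ 1) {y : G} {N : ℕ} (hN : 0 < N)
    (hy : gs.sl^[N] y = y) (n : ℕ) : gs.gsup (gs.sl^[n] y) = gs.gsup y := by
  rw [gsup_eq_neg_ginf_inv, gsup_eq_neg_ginf_inv, ← sl_iterate_inv,
    gs.ginf_sl_iterate_eq hΔ hN (by rw [sl_iterate_inv, hy])]

theorem finite_pre_Delta_pow (m : ℕ) :
    {c : G | c ∈ gs.P ∧ gs.pre c (gs.Δ ^ (m : ℤ))}.Finite := by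
  induction m with
  | zero =>
    refine (Set.finite_singleton (1 : G)).subset fun c hc => ?_
    exact gs.eq_one_of_mem_of_inv_mem c hc.1 (by simpa [pre] using hc.2)
  | succ m ih =>
    refine (Set.Finite.image2 (· * ·) gs.simples_finite ih).subset fun c hc => ?_
    have hc1 : gs.pre 1 c := by simpa [pre] using hc.1
    refine ⟨gs.wedge c gs.Δ, ⟨?_, gs.wedge_pre_right _ _⟩, (gs.wedge c gs.Δ)⁻¹ * c,
      ⟨gs.wedge_pre_left _ _, ?_⟩, by simp⟩
    · simpa [pre] using hc1.wedge (show gs.pre 1 gs.Δ by simpa [pre] using gs.Δ_mem)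
    · rw [← gs.pre_mul_left_iff (gs.wedge c gs.Δ), mul_inv_cancel_left, wedge_mul_zpow]
      refine pre.wedge (gs.pre_mul_of_mem c (gs.Delta_zpow_mem (by lia))) ?_
      rw [← zpow_one_add, add_comm]
      exact_mod_cast hc.2

/-- Only finitely many elements lie between two given powers of `Δ`. -/
theorem finite_Icc_Delta_zpow (a b : ℤ) :
    {c : G | gs.pre (gs.Δ ^ a) c ∧ gs.pre c (gs.Δ ^ b)}.Finite := by
  refine ((gs.finite_pre_Delta_pow (b - a).toNat).image (gs.Δ ^ a * ·)).subset fun c hc => ?_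
  refine ⟨(gs.Δ ^ a)⁻¹ * c, ⟨hc.1, ?_⟩, by simp⟩
  rw [← gs.pre_mul_left_iff (gs.Δ ^ a), mul_inv_cancel_left, ← zpow_add]
  exact hc.2.trans (gs.Delta_zpow_pre (by lia))

/-- The product of the preferred prefixes of `x, 𝔰(x), …, 𝔰^{n-1}(x)`. -/
noncomputable def slidingConj (x : G) : ℕ → G
  | 0 => 1
  | n + 1 => slidingConj x n * gs.pp (gs.sl^[n] x)

theorem sl_iterate_eq_conj (x : G) (n : ℕ) :
    gs.sl^[n] x = (gs.slidingConj x n)⁻¹ * x * gs.slidingConj x n := by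
  induction n with
  | zero => simp [slidingConj]
  | succ n ih =>
    rw [Function.iterate_succ_apply', sl, slidingConj]
    nth_rewrite 2 [ih]
    group

theorem slidingConj_add (x : G) (m n : ℕ) :
    gs.slidingConj x (m + n) = gs.slidingConj x m * gs.slidingConj (gs.sl^[m] x) n := by
  induction n with
  | zero => simp [slidingConj]
  | succ n ih =>
    rw [← add_assoc, slidingConj, ih, slidingConj, mul_assoc, ← Function.iterate_add_apply,
      add_comm n m]

theorem transportIter_eq (x α : G) (n : ℕ) :
    gs.transportIter x α n =
      (gs.slidingConj x n)⁻¹ * α * gs.slidingConj (α⁻¹ * x * α) n := by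
  induction n with
  | zero => simp [transportIter, slidingConj]
  | succ n ih =>
    have h : (gs.transportIter x α n)⁻¹ * gs.sl^[n] x * gs.transportIter x α n =
        gs.sl^[n] (α⁻¹ * x * α) := by
      rw [sl_iterate_eq_conj, sl_iterate_eq_conj, ih]
      group
    rw [transportIter, transport, h, ih, slidingConj, slidingConj]
    group

theorem conj_transportIter (x α : G) (n : ℕ) :
    (gs.transportIter x α n)⁻¹ * gs.sl^[n] x * gs.transportIter x α n =
      gs.sl^[n] (α⁻¹ * x * α) := by
  rw [transportIter_eq, sl_iterate_eq_conj, sl_iterate_eq_conj]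
  group

/-- Left translate of the preferred prefix of a conjugate. -/
theorem mul_pp_conj (x α : G) :
    α * gs.pp (α⁻¹ * x * α) =
      gs.wedge (gs.wedge (x * α * gs.Δ ^ (-gs.ginf (α⁻¹ * x * α)))
        (x⁻¹ * α * gs.Δ ^ gs.gsup (α⁻¹ * x * α))) (α * gs.Δ) := by
  rw [pp, mul_wedge, mul_wedge]
  congr 2 <;> group

theorem pp_mul_zpow (x : G) (k : ℤ) :
    gs.pp x * gs.Δ ^ k =
      gs.wedge (gs.wedge (x * gs.Δ ^ k * gs.Δ ^ (-gs.ginf x))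
        (x⁻¹ * gs.Δ ^ k * gs.Δ ^ gs.gsup x)) (gs.Δ ^ k * gs.Δ) := by
  have hcomm (u : G) (l : ℤ) : u * gs.Δ ^ l * gs.Δ ^ k = u * gs.Δ ^ k * gs.Δ ^ l := by
    rw [mul_assoc, mul_assoc, ← zpow_add, ← zpow_add, add_comm]
  rw [pp, wedge_mul_zpow, wedge_mul_zpow, hcomm, hcomm, mul_self_zpow, mul_zpow_self]

variable {gs} in
theorem pre.wedge_mono {a b c d : G} (h : gs.pre a b) (h' : gs.pre c d) :
    gs.pre (gs.wedge a c) (gs.wedge b d) :=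
  ((gs.wedge_pre_left _ _).trans h).wedge ((gs.wedge_pre_right _ _).trans h')

/-- Transport preserves lower and upper bounds which are powers of `Δ`. -/
theorem transport_bounds {x α : G} {a b : ℤ} (ha : gs.pre (gs.Δ ^ a) α)
    (hb : gs.pre α (gs.Δ ^ b)) (hinf : gs.ginf (α⁻¹ * x * α) = gs.ginf x)
    (hsup : gs.gsup (α⁻¹ * x * α) = gs.gsup x) :
    gs.pre (gs.Δ ^ a) (gs.transport x α) ∧ gs.pre (gs.transport x α) (gs.Δ ^ b) := by
  rw [transport, ← gs.pre_mul_left_iff (gs.pp x), ← gs.pre_mul_left_iff (gs.pp x) _ (gs.Δ ^ b),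
    mul_assoc, mul_inv_cancel_left, mul_pp_conj, hinf, hsup, pp_mul_zpow, pp_mul_zpow]
  have hΔ {u v : G} (h : gs.pre u v) : gs.pre (u * gs.Δ) (v * gs.Δ) := by
    simpa using h.mul_zpow 1
  exact
    ⟨(((ha.mul_left x).mul_zpow _).wedge_mono ((ha.mul_left x⁻¹).mul_zpow _)).wedge_mono (hΔ ha),
    (((hb.mul_left x).mul_zpow _).wedge_mono ((hb.mul_left x⁻¹).mul_zpow _)).wedge_mono (hΔ hb)⟩

/-- A descending sequence bounded by powers of `Δ` has two equal consecutive terms. -/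
theorem exists_succ_eq_of_descending {f : ℕ → G} (hf : ∀ n, gs.pre (f (n + 1)) (f n)) {a b : ℤ}
    (ha : ∀ n, gs.pre (gs.Δ ^ a) (f n)) (hb : ∀ n, gs.pre (f n) (gs.Δ ^ b)) :
    ∃ n, f (n + 1) = f n := by
  obtain ⟨i, j, hij, h⟩ := Set.Finite.exists_lt_map_eq_of_forall_mem (f := f)
    (t := {c : G | gs.pre (gs.Δ ^ a) c ∧ gs.pre c (gs.Δ ^ b)}) (fun n => ⟨ha n, hb n⟩)
    (gs.finite_Icc_Delta_zpow a b)
  have hle : ∀ k, gs.pre (f (i + 1 + k)) (f (i + 1)) := by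
    intro k
    induction k with
    | zero => exact gs.pre_refl _
    | succ k ih => exact (hf _).trans ih
  refine ⟨i, (hf i).antisymm ?_⟩
  have := hle (j - (i + 1))
  rwa [Nat.add_sub_cancel' hij, ← h] at this

/-- The meet of the elements `y ^ j * Δ ^ (-k * j)` for `j ≤ n`. -/
noncomputable def powMeet (y : G) (k : ℤ) : ℕ → G
  | 0 => 1
  | n + 1 => gs.wedge (powMeet y k n) (y ^ (n + 1) * gs.Δ ^ (-k * (n + 1 : ℕ)))

theorem powMeet_pre (y : G) (k : ℤ) (n : ℕ) :
    gs.pre (gs.powMeet y k n) (y ^ n * gs.Δ ^ (-k * n)) := by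
  cases n with
  | zero => simpa [powMeet] using gs.pre_refl 1
  | succ n => exact gs.wedge_pre_right _ _

theorem powMeet_pre_one (y : G) (k : ℤ) (n : ℕ) : gs.pre (gs.powMeet y k n) 1 := by
  induction n with
  | zero => exact gs.pre_refl 1
  | succ n ih => exact (gs.wedge_pre_left _ _).trans ih

theorem pre_powMeet {y c : G} {k : ℤ} (h : ∀ j : ℕ, gs.pre c (y ^ j * gs.Δ ^ (-k * j))) (n : ℕ) :
    gs.pre c (gs.powMeet y k n) := by
  induction n with
  | zero => simpa [powMeet] using h 0
  | succ n ih => exact ih.wedge (h (n + 1))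

/-- If a conjugate of `y` has infimum at least `k`, then the elements `y ^ j * Δ ^ (-k * j)` have
a common lower bound which is a power of `Δ`. -/
theorem exists_Delta_zpow_pre_pow {y α : G} {k : ℤ} (h : gs.pre (gs.Δ ^ k) (α⁻¹ * y * α)) :
    ∃ a : ℤ, ∀ j : ℕ, gs.pre (gs.Δ ^ a) (y ^ j * gs.Δ ^ (-k * j)) := by
  have hpow : ∀ j : ℕ, gs.pre (α * gs.Δ ^ (k * j)) (y ^ j * α) := by
    intro j
    induction j with
    | zero => simpa using gs.pre_refl α
    | succ j ih =>
      have h1 := ih.mul_zpow k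
      have h2 := h.mul_left (y ^ j * α)
      rw [mul_assoc α, ← zpow_add] at h1
      convert h1.trans h2 using 1
      · push_cast; ring_nf
      · rw [pow_succ]; group
  obtain ⟨m, hm, hm'⟩ := gs.exists_Delta_zpow_bounds α
  refine ⟨-m - m, fun j => ?_⟩
  have h1 := (hm.mul_zpow (k * j)).trans ((hpow j).trans (hm'.mul_left (y ^ j)))
  have h2 := h1.mul_zpow (-k * j - m)
  rw [mul_assoc (y ^ j), ← zpow_add, ← zpow_add, ← zpow_add] at h2
  convert h2 using 3 <;> ring

theorem slidingConj_succ {y : G} {p q : ℤ} (n : ℕ) (hp : gs.ginf (gs.sl^[n] y) = p)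
    (hq : gs.gsup (gs.sl^[n] y) = q) :
    gs.slidingConj y (n + 1) =
      gs.wedge (gs.wedge (y * gs.slidingConj y n * gs.Δ ^ (-p))
        (y⁻¹ * gs.slidingConj y n * gs.Δ ^ q)) (gs.slidingConj y n * gs.Δ) := by
  rw [sl_iterate_eq_conj] at hp hq
  rw [slidingConj, sl_iterate_eq_conj, mul_pp_conj, hp, hq]

theorem slidingConj_succ_pre_mul {y : G} {p q : ℤ}
    (hp : ∀ n, gs.ginf (gs.sl^[n] y) = p) (hq : ∀ n, gs.gsup (gs.sl^[n] y) = q)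
    (n : ℕ) :
    gs.pre (gs.slidingConj y (n + 1)) (y * gs.slidingConj y n * gs.Δ ^ (-p)) := by
  rw [gs.slidingConj_succ n (hp n) (hq n)]
  exact (gs.wedge_pre_left _ _).trans (gs.wedge_pre_left _ _)

theorem slidingConj_succ_pre_mul_Delta {y : G} {p q : ℤ}
    (hp : ∀ n, gs.ginf (gs.sl^[n] y) = p) (hq : ∀ n, gs.gsup (gs.sl^[n] y) = q)
    (n : ℕ) :
    gs.pre (gs.slidingConj y (n + 1)) (gs.slidingConj y n * gs.Δ) := by
  rw [gs.slidingConj_succ n (hp n) (hq n)]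
  exact gs.wedge_pre_right _ _

theorem slidingConj_pre_pow {y : G} {p q : ℤ}
    (hp : ∀ n, gs.ginf (gs.sl^[n] y) = p) (hq : ∀ n, gs.gsup (gs.sl^[n] y) = q)
    (n : ℕ) :
    gs.pre (gs.slidingConj y n) (y ^ n * gs.Δ ^ (-p * n)) := by
  induction n with
  | zero => simpa [slidingConj] using gs.pre_refl 1
  | succ n ih =>
    refine (gs.slidingConj_succ_pre_mul hp hq n).trans ?_
    convert (ih.mul_left y).mul_zpow (-p) using 1
    rw [pow_succ', ← mul_assoc, mul_assoc, mul_assoc, mul_assoc, ← zpow_add]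
    push_cast; ring_nf

theorem slidingConj_pre_powMeet {y : G} {p q : ℤ}
    (hp : ∀ n, gs.ginf (gs.sl^[n] y) = p) (hq : ∀ n, gs.gsup (gs.sl^[n] y) = q)
    (n : ℕ) :
    gs.pre (gs.slidingConj y n) (gs.powMeet y (p + 1) n * gs.Δ ^ (n : ℤ)) := by
  induction n with
  | zero => simpa [slidingConj, powMeet] using gs.pre_refl 1
  | succ n ih =>
    rw [powMeet, wedge_mul_zpow]
    refine pre.wedge ((gs.slidingConj_succ_pre_mul_Delta hp hq n).trans ?_) ?_
    · convert ih.mul_zpow 1 using 1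
      · rw [zpow_one]
      · rw [mul_assoc, ← zpow_add]; norm_cast
    · convert gs.slidingConj_pre_pow hp hq (n + 1) using 1
      rw [mul_assoc, ← zpow_add]
      congr 2; ring

theorem wedge_pre_mul_slidingConj {y : G} {p q : ℤ}
    (hp : ∀ n, gs.ginf (gs.sl^[n] y) = p) (hq : ∀ n, gs.gsup (gs.sl^[n] y) = q)
    (hpq : p + 2 ≤ q) (n : ℕ) :
    gs.pre (gs.wedge (gs.slidingConj y n * gs.Δ ^ (p + 1)) (y ^ (n + 1) * gs.Δ ^ (-p * n)))
      (y * gs.slidingConj y n) := by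
  induction n with
  | zero =>
    refine (gs.wedge_pre_right _ _).trans ?_
    simpa [slidingConj] using gs.pre_refl y
  | succ n ih =>
    set P := gs.slidingConj y n with hP
    have h1 := (gs.slidingConj_succ_pre_mul hp hq n).mul_zpow (p + 1)
    have h2 := (gs.slidingConj_succ_pre_mul_Delta hp hq n).mul_zpow (p + 1)
    rw [← hP, mul_assoc (y * P), ← zpow_add, neg_add_cancel_left, zpow_one] at h1
    rw [← hP, mul_assoc P, ← zpow_one_add] at h2
    rw [gs.slidingConj_succ n (hp n) (hq n), ← hP] at h1 h2 ⊢
    rw [mul_wedge, mul_wedge]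
    refine pre.wedge (pre.wedge ?_ ?_) ?_
    · have h3 := (ih.mul_left y).mul_zpow (-p)
      rw [mul_wedge, wedge_mul_zpow] at h3
      simp only [← mul_assoc] at h3 ⊢
      refine pre.trans (pre.wedge_mono ?_ ?_) h3
      · convert h1 using 1
        rw [mul_assoc (y * P), ← zpow_add, add_neg_cancel_comm, zpow_one]
      · convert gs.pre_refl _ using 1
        rw [pow_succ' y (n + 1), mul_assoc (y * y ^ (n + 1)), ← zpow_add]
        push_cast; ring_nf
    · refine (gs.wedge_pre_left _ _).trans (h2.trans ?_)
      simp only [mul_assoc, mul_inv_cancel_left]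
      exact gs.mul_Delta_zpow_pre P (by lia)
    · rw [← mul_assoc]
      exact (gs.wedge_pre_left _ _).trans h1

theorem ginf_conj_le_of_const {y : G} {p q : ℤ}
    (hp : ∀ n, gs.ginf (gs.sl^[n] y) = p) (hq : ∀ n, gs.gsup (gs.sl^[n] y) = q)
    (hΔ : gs.Δ ≠ 1) (α : G) : gs.ginf (α⁻¹ * y * α) ≤ p := by
  by_contra! hlt
  obtain ⟨a, ha⟩ := gs.exists_Delta_zpow_pre_pow
    ((gs.Delta_zpow_pre_iff_le_ginf hΔ _ (p + 1)).2 hlt)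
  rcases le_or_gt (p + 2) q with hpq | hpq
  · obtain ⟨n, hn⟩ := gs.exists_succ_eq_of_descending (f := gs.powMeet y (p + 1)) (b := 0)
      (fun n => gs.wedge_pre_left _ _) (fun n => gs.pre_powMeet ha n)
      (fun n => by simpa using gs.powMeet_pre_one y (p + 1) n)
    have h1 := gs.powMeet_pre y (p + 1) (n + 1)
    rw [hn] at h1
    have h2 := ((gs.slidingConj_pre_powMeet hp hq n).trans (h1.mul_zpow n)).mul_zpow (p + 1)
    have h3 : gs.pre (gs.slidingConj y n * gs.Δ ^ (p + 1)) (y * gs.slidingConj y n) := by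
      refine pre.trans (pre.wedge (gs.pre_refl _) ?_)
        (gs.wedge_pre_mul_slidingConj hp hq hpq n)
      convert h2 using 1
      rw [mul_assoc, mul_assoc, ← zpow_add, ← zpow_add]
      push_cast; ring_nf
    have h4 : gs.pre (gs.Δ ^ (p + 1)) (gs.sl^[n] y) := by
      rw [sl_iterate_eq_conj, ← gs.pre_mul_left_iff (gs.slidingConj y n)]
      simpa [mul_assoc] using h3
    rw [gs.Delta_zpow_pre_iff_le_ginf hΔ, hp] at h4
    lia
  · have hy : gs.pre y (gs.Δ ^ (p + 1)) := by
      rw [gs.pre_Delta_zpow_iff_gsup_le hΔ, show gs.gsup y = q from hq 0]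
      lia
    have hstep (j : ℕ) : y ^ (j + 1) * gs.Δ ^ (-(p + 1) * (j + 1 : ℕ)) =
        y ^ j * y * gs.Δ ^ (-(p + 1)) * gs.Δ ^ (-(p + 1) * j) := by
      rw [pow_succ, mul_assoc _ (gs.Δ ^ _) (gs.Δ ^ _), ← zpow_add]
      push_cast; ring_nf
    have hdesc (j : ℕ) : gs.pre (y ^ (j + 1) * gs.Δ ^ (-(p + 1) * (j + 1 : ℕ)))
        (y ^ j * gs.Δ ^ (-(p + 1) * j)) := by
      rw [hstep]
      refine pre.mul_zpow ?_ _
      have := (hy.mul_zpow (-(p + 1))).mul_left (y ^ j)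
      rwa [← zpow_add, add_neg_cancel, zpow_zero, mul_one, ← mul_assoc] at this
    obtain ⟨j, hj⟩ := gs.exists_succ_eq_of_descending
      (f := fun j : ℕ => y ^ j * gs.Δ ^ (-(p + 1) * (j : ℤ))) (b := 0) hdesc ha
      (fun n => by
        induction n with
        | zero => simpa using gs.pre_refl 1
        | succ n ih => exact (hdesc n).trans ih)
    have h5 : gs.pre (gs.Δ ^ (p + 1)) y := by
      have := (hstep j).symm.trans hj
      rw [mul_left_inj, mul_assoc, mul_eq_left, zpow_neg, mul_inv_eq_one] at this
      rw [← this]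
      exact gs.pre_refl y
    rw [gs.Delta_zpow_pre_iff_le_ginf hΔ, show gs.ginf y = p from hp 0] at h5
    lia

/-- An element of a sliding circuit has maximal infimum in its conjugacy class. -/
theorem ginf_conj_le (hΔ : gs.Δ ≠ 1) {y : G} {N : ℕ} (hN : 0 < N) (hy : gs.sl^[N] y = y)
    (α : G) : gs.ginf (α⁻¹ * y * α) ≤ gs.ginf y :=
  gs.ginf_conj_le_of_const (gs.ginf_sl_iterate_eq hΔ hN hy) (gs.gsup_sl_iterate_eq hΔ hN hy) hΔ α

/-- An element of a sliding circuit has minimal supremum in its conjugacy class. -/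
theorem le_gsup_conj (hΔ : gs.Δ ≠ 1) {y : G} {N : ℕ} (hN : 0 < N) (hy : gs.sl^[N] y = y)
    (α : G) : gs.gsup y ≤ gs.gsup (α⁻¹ * y * α) := by
  have h := gs.ginf_conj_le hΔ hN (y := y⁻¹) (by rw [sl_iterate_inv, hy]) α
  rw [gsup_eq_neg_ginf_inv, gsup_eq_neg_ginf_inv]
  simpa [mul_assoc] using h

/-- The iterated transports along a sliding circuit, of an element conjugating into the super
summit set, take finitely many values. -/
theorem finite_range_transportIter (hΔ : gs.Δ ≠ 1) {x y s : G} (hy : y ∈ gs.SC x)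
    (hs : s⁻¹ * y * s ∈ gs.SSS x) : (Set.range (gs.transportIter y s)).Finite := by
  obtain ⟨⟨β, rfl⟩, N, hN, hNy⟩ := hy
  set y := β⁻¹ * x * β with hy
  obtain ⟨-, hmax⟩ := hs
  set z := s⁻¹ * y * s with hz
  have hzn (n : ℕ) : gs.ginf (gs.sl^[n] z) = gs.ginf (gs.sl^[n] y) ∧
      gs.gsup (gs.sl^[n] z) = gs.gsup (gs.sl^[n] y) := by
    rw [gs.ginf_sl_iterate_eq hΔ hN hNy, gs.gsup_sl_iterate_eq hΔ hN hNy]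
    have hconj : (s * gs.slidingConj z n)⁻¹ * y * (s * gs.slidingConj z n) = gs.sl^[n] z := by
      rw [sl_iterate_eq_conj, hz]; group
    have h1 := gs.ginf_conj_le hΔ hN hNy (s * gs.slidingConj z n)
    have h2 := gs.le_gsup_conj hΔ hN hNy (s * gs.slidingConj z n)
    rw [hconj] at h1 h2
    have h3 := hmax y ⟨β, rfl⟩
    have h4 := gs.ginf_le_ginf_sl_iterate hΔ z n
    have h5 := gs.ginf_le_ginf_sl_iterate hΔ z⁻¹ n
    have h6 := gs.gsup_eq_neg_ginf_inv z
    have h7 := gs.gsup_eq_neg_ginf_inv (gs.sl^[n] z)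
    rw [sl_iterate_inv] at h5
    lia
  obtain ⟨k, hk, hk'⟩ := gs.exists_Delta_zpow_bounds s
  refine (gs.finite_Icc_Delta_zpow (-k) k).subset ?_
  rintro _ ⟨n, rfl⟩
  induction n with
  | zero => exact ⟨hk, hk'⟩
  | succ n ih =>
    refine gs.transport_bounds ih.1 ih.2 ?_ ?_ <;> rw [conj_transportIter]
    exacts [(hzn n).1, (hzn n).2]

theorem exists_transportIter_eq {x y s : G} (hy : y ∈ gs.SC x)
    (hs : s⁻¹ * y * s ∈ gs.SSS x) (N : ℕ) :
    ∃ i j : ℕ, i < j ∧ gs.transportIter y s (i * N) = gs.transportIter y s (j * N) := by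
  by_cases hΔ : gs.Δ = 1
  · exact ⟨0, 1, one_pos, by rw [gs.eq_one_of_Delta_eq_one hΔ (gs.transportIter y s _),
      gs.eq_one_of_Delta_eq_one hΔ (gs.transportIter y s (1 * N))]⟩
  · exact Set.Finite.exists_lt_map_eq_of_forall_mem (f := fun i => gs.transportIter y s (i * N))
      (fun i => Set.mem_range_self (i * N)) (gs.finite_range_transportIter hΔ hy hs)

/-- If both ends of a conjugation are fixed by `M` slidings, a coincidence between iterated
transports whose indices differ by `M` comes from a fixed point. -/
theorem transportIter_eq_self {y s : G} {m M : ℕ} (hy : gs.sl^[M] y = y)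
    (hz : gs.sl^[M] (s⁻¹ * y * s) = s⁻¹ * y * s)
    (h : gs.transportIter y s m = gs.transportIter y s (M + m)) :
    gs.transportIter y s M = s := by
  rw [transportIter_eq, transportIter_eq, slidingConj_add, slidingConj_add, hy, hz] at h
  rw [transportIter_eq]
  generalize s⁻¹ * y * s = z at h ⊢
  rw [mul_inv_rev, ← mul_assoc, mul_left_inj, mul_assoc, mul_assoc, mul_right_inj] at h
  rw [mul_assoc, ← h]

end GarsideStructure

open GarsideStructure

variable {G : Type*} [Group G]

/-- Iterated transport along a sliding circuit becomes periodic, and `y^s ∈ SC(x)` if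
and only if `s` is a fixed point of some iterated transport along the circuit. -/
theorem transport_fixed_points (gs : GarsideStructure G) (x y s : G)
    (hy : y ∈ gs.SC x) (hs : s⁻¹ * y * s ∈ gs.SSS x)
    (N : ℕ) (hN : 0 < N) (hNy : (gs.sl)^[N] y = y) :
    (∃ i₁ i₂ : ℕ, i₁ < i₂ ∧
        gs.transportIter y s (i₁ * N) = gs.transportIter y s (i₂ * N)) ∧
    (s⁻¹ * y * s ∈ gs.SC x ↔ ∃ k : ℕ, 0 < k ∧ gs.transportIter y s (k * N) = s) := by
  refine ⟨gs.exists_transportIter_eq hy hs N, fun ⟨_, M, hM, hMz⟩ => ?_, fun ⟨k, hk, h⟩ => ?_⟩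
  · obtain ⟨i, j, hij, h⟩ := gs.exists_transportIter_eq hy hs (M * N)
    obtain ⟨d, rfl⟩ := Nat.exists_eq_add_of_lt hij
    refine ⟨(d + 1) * M, by positivity, gs.transportIter_eq_self (m := i * (M * N)) ?_ ?_ ?_⟩
    · rw [mul_comm, Function.iterate_mul]
      exact Function.iterate_fixed hNy _
    · rw [mul_assoc, mul_left_comm, Function.iterate_mul]
      exact Function.iterate_fixed hMz _
    · rw [h]
      congr 1
      ring
  · refine ⟨hs.1, k * N, Nat.mul_pos hk hN, ?_⟩
    have hk' : gs.sl^[k * N] y = y := by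
      rw [mul_comm, Function.iterate_mul]
      exact Function.iterate_fixed hNy k
    rw [← conj_transportIter, h, hk']
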